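/- arXiv:2211.13567 — 2 statements merged into one kernel-verified Lean document; each statement's English description precedes it below -/
import Mathlib

section
/- Let k, m, n be positive integers such that k divides n. If there is no party-approval rule for n voters, m parties, and committee size k satisfying anonymity, weak representation, and strategyproofness, then there is no party-approval rule for n(k+1)/k voters, m+1 parties, and committee size k+1 satisfying anonymity, weak representation, and strategyproofness. -/
/-- An approval profile is valid if every voter's ballot is nonempty. -/
def ValidProfile {P : Type*} (n : ℕ) (A : Fin n → Finset P) : Prop :=
  ∀ i, (A i).Nonempty

/-- The number of seats a committee `W` assigns to the parties in `X`. -/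
def seats {P : Type*} [DecidableEq P] (W : Multiset P) (X : Finset P) : ℕ :=
  ∑ x ∈ X, W.count x

/-- A party-approval rule for `n` voters and committee size `k`:
it assigns to every (valid) approval profile a committee of size `k`. -/
def IsPAPPRule {P : Type*} (n k : ℕ) (f : (Fin n → Finset P) → Multiset P) : Prop :=
  ∀ A, ValidProfile n A → Multiset.card (f A) = k

/-- Anonymity: permuting the voters does not change the outcome. -/
def Anonymous {P : Type*} (n : ℕ) (f : (Fin n → Finset P) → Multiset P) : Prop :=
  ∀ A, ValidProfile n A → ∀ π : Equiv.Perm (Fin n), f (fun i => A (π i)) = f A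

/-- Weak representation: a party uniquely approved by at least `n / k` voters
gets at least one seat. -/
def WeakRep {P : Type*} [DecidableEq P] (n k : ℕ)
    (f : (Fin n → Finset P) → Multiset P) : Prop :=
  ∀ A, ValidProfile n A → ∀ (x : P) (G : Finset (Fin n)),
    n ≤ k * G.card → (∀ i ∈ G, A i = {x}) → 1 ≤ (f A).count x

/-- Weak proportional representation: a party uniquely approved by at least
`ℓ * n / k` voters gets at least `ℓ` seats. -/
def WeakPropRep {P : Type*} [DecidableEq P] (n k : ℕ)
    (f : (Fin n → Finset P) → Multiset P) : Prop :=
  ∀ A, ValidProfile n A → ∀ (x : P) (G : Finset (Fin n)) (ℓ : ℕ),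
    1 ≤ ℓ → ℓ * n ≤ k * G.card → (∀ i ∈ G, A i = {x}) → ℓ ≤ (f A).count x

/-- Strategyproofness: no voter can increase the number of seats assigned to
her approved parties by misreporting her ballot. -/
def Strategyproof {P : Type*} [DecidableEq P] (n : ℕ)
    (f : (Fin n → Finset P) → Multiset P) : Prop :=
  ∀ A A' : Fin n → Finset P, ValidProfile n A → ValidProfile n A' →
    ∀ i : Fin n, (∀ j, j ≠ i → A j = A' j) →
      seats (f A') (A i) ≤ seats (f A) (A i)

lemma seats_cons {P : Type*} [DecidableEq P] (y : P) (W : Multiset P) (X : Finset P) :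
    seats (y ::ₘ W) X = seats W X + if y ∈ X then 1 else 0 := by
  simp [seats, Multiset.count_cons, Finset.sum_add_distrib]

lemma seats_map {P Q : Type*} [Fintype P] [DecidableEq P] [DecidableEq Q] (r : P → Q)
    (W : Multiset P) (X : Finset Q) :
    seats (W.map r) X = seats W ({p | r p ∈ X} : Finset P) := by
  induction W using Multiset.induction_on with
  | empty => simp [seats]
  | cons a W ih => simp [seats_cons, ih]

lemma seats_singleton {P : Type*} [DecidableEq P] (W : Multiset P) (x : P) :
    seats W {x} = W.count x := by
  simp [seats]

/-- If a group of voters all of whose true ballot is `T` misreports jointly, the number of seats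
assigned to `T` does not increase. -/
lemma Strategyproof.seats_le_of_group {P : Type*} [DecidableEq P] {n : ℕ}
    {f : (Fin n → Finset P) → Multiset P} (hf : Strategyproof n f) {T : Finset P}
    (S : Finset (Fin n)) {A B : Fin n → Finset P} (hA : ValidProfile n A)
    (hB : ValidProfile n B) (hout : ∀ i ∉ S, A i = B i) (hin : ∀ i ∈ S, A i = T) :
    seats (f B) T ≤ seats (f A) T := by
  induction S using Finset.induction_on generalizing A with
  | empty => rw [show A = B from funext fun i => hout i (by simp)]
  | insert a S ha ih =>
    have hC : ValidProfile n (Function.update A a (B a)) := by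
      intro i
      by_cases h : i = a
      · subst h; simpa using hB i
      · simpa [h] using hA i
    refine (ih hC ?_ ?_).trans ?_
    · intro i hi
      by_cases h : i = a
      · subst h; simp
      · simpa [h] using hout i (by simp [h, hi])
    · intro i hi
      have h : i ≠ a := fun h => ha (h ▸ hi)
      simpa [h] using hin i (by simp [hi])
    · have := hf A _ hA hC a fun j hj => by simp [hj]
      rwa [hin a (by simp)] at this

/-- The map sending the additional party to `y` and fixing all other parties. -/
def mergeLast {m : ℕ} (y : Fin m) (p : Fin (m + 1)) : Fin m :=
  Fin.lastCases (motive := fun _ => Fin m) y id p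

@[simp] lemma mergeLast_last {m : ℕ} (y : Fin m) : mergeLast y (Fin.last m) = y := by
  simp [mergeLast]

@[simp] lemma mergeLast_castSucc {m : ℕ} (y x : Fin m) : mergeLast y x.castSucc = x := by
  simp [mergeLast]

/-- The profile in which the ballots of `A` are pulled back along `mergeLast y`, and `q` new voters
approve exactly the additional party. -/
def extendProfile {m n : ℕ} (y : Fin m) (q : ℕ) (A : Fin n → Finset (Fin m)) :
    Fin (n + q) → Finset (Fin (m + 1)) :=
  Fin.append (fun i => Finset.univ.filter fun p => mergeLast y p ∈ A i) fun _ => {Fin.last m}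

lemma extendProfile_castAdd {m n : ℕ} (y : Fin m) (q : ℕ) (A : Fin n → Finset (Fin m))
    (i : Fin n) :
    extendProfile y q A (Fin.castAdd q i) = ({p | mergeLast y p ∈ A i} : Finset _) := by
  simp [extendProfile]

lemma extendProfile_natAdd {m n : ℕ} (y : Fin m) (q : ℕ) (A : Fin n → Finset (Fin m))
    (j : Fin q) : extendProfile y q A (Fin.natAdd n j) = {Fin.last m} := by
  simp [extendProfile]

lemma ValidProfile.extendProfile {m n : ℕ} (y : Fin m) (q : ℕ) {A : Fin n → Finset (Fin m)}
    (hA : ValidProfile n A) : ValidProfile (n + q) (extendProfile y q A) := by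
  intro i
  induction i using Fin.addCases with
  | left i =>
    obtain ⟨x, hx⟩ := hA i
    exact ⟨x.castSucc, by simpa [extendProfile_castAdd] using hx⟩
  | right j => simp [extendProfile_natAdd]

lemma exists_rule_of_exists_rule_add {k m n q : ℕ} (y : Fin m) (hn : n = k * q)
    {f : (Fin (n + q) → Finset (Fin (m + 1))) → Multiset (Fin (m + 1))}
    (hr : IsPAPPRule (n + q) (k + 1) f) (ha : Anonymous (n + q) f)
    (hw : WeakRep (n + q) (k + 1) f) (hs : Strategyproof (n + q) f) (hk : 1 ≤ k) :
    ∃ g : (Fin n → Finset (Fin m)) → Multiset (Fin m),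
      IsPAPPRule n k g ∧ Anonymous n g ∧ WeakRep n k g ∧ Strategyproof n g := by
  have hquota {c : ℕ} (hc : n ≤ k * c) : n + q ≤ (k + 1) * c := by
    have : q ≤ c := Nat.le_of_mul_le_mul_left (hn ▸ hc) hk
    linarith
  have hlast {B : Fin (n + q) → Finset (Fin (m + 1))} (hB : ValidProfile (n + q) B)
      (hBq : ∀ j : Fin q, B (Fin.natAdd n j) = {Fin.last m}) :
      1 ≤ (f B).count (Fin.last m) := by
    refine hw B hB _ (Finset.univ.map (Fin.natAddEmb n)) (hquota (by simp [hn])) ?_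
    simpa using hBq
  have hy {A : Fin n → Finset (Fin m)} (hA : ValidProfile n A) :
      y ∈ (f (extendProfile y q A)).map (mergeLast y) := by
    refine Multiset.mem_map.2 ⟨Fin.last m, ?_, by simp⟩
    exact Multiset.one_le_count_iff_mem.1
      (hlast (hA.extendProfile y q) (extendProfile_natAdd y q A))
  have hseats {A : Fin n → Finset (Fin m)} (hA : ValidProfile n A) (X : Finset (Fin m)) :
      seats (f (extendProfile y q A)) ({p | mergeLast y p ∈ X} : Finset _) =
        seats (((f (extendProfile y q A)).map (mergeLast y)).erase y) X +
          if y ∈ X then 1 else 0 := by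
    rw [← seats_cons, Multiset.cons_erase (hy hA), seats_map]
  refine ⟨fun A => ((f (extendProfile y q A)).map (mergeLast y)).erase y, ?_, ?_, ?_, ?_⟩
  · intro A hA
    rw [Multiset.card_erase_of_mem (hy hA), Multiset.card_map, hr _ (hA.extendProfile y q)]
    rfl
  · intro A hA π
    have h := ha _ (hA.extendProfile y q) (finSumFinEquiv.permCongr (π.sumCongr (Equiv.refl _)))
    have hπ : extendProfile y q (fun i => A (π i)) = fun i =>
        extendProfile y q A (finSumFinEquiv.permCongr (π.sumCongr (Equiv.refl (Fin q))) i) := by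
      funext i
      induction i using Fin.addCases with
      | left i => simp [extendProfile_castAdd, Equiv.permCongr_apply]
      | right j => simp [extendProfile_natAdd, Equiv.permCongr_apply]
    simp only [hπ, h]
  · intro A hA x G hG hGx
    beta_reduce
    have hS := hseats hA {x}
    rw [seats_singleton] at hS
    -- Let the members of `G` approve only `x` itself, not the additional party.
    set G' := G.map (Fin.castAddEmb q) with hG'
    let B : Fin (n + q) → Finset (Fin (m + 1)) := fun i =>
      if i ∈ G' then {x.castSucc} else extendProfile y q A i
    have hB : ValidProfile (n + q) B := by
      intro i
      by_cases hi : i ∈ G'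
      · simp [B, hi]
      · simpa [B, hi] using hA.extendProfile y q i
    have hle := hs.seats_le_of_group (T := {p | mergeLast y p ∈ ({x} : Finset _)}) G'
      (hA.extendProfile y q) hB (fun i hi => by simp [B, hi]) (by
        intro i hi
        obtain ⟨j, hj, rfl⟩ := Finset.mem_map.1 hi
        simp [extendProfile_castAdd, hGx j hj])
    have hx : 1 ≤ (f B).count x.castSucc :=
      hw B hB _ G' (hquota (by simpa [hG'] using hG)) fun i hi => by simp [B, hi]
    have hl : 1 ≤ (f B).count (Fin.last m) := hlast hB fun j => by
      have : Fin.natAdd n j ∉ G' := by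
        simp only [hG', Finset.mem_map, not_exists, not_and]
        intro i _ h
        have := congrArg Fin.val h
        simp at this
        omega
      simp [B, this, extendProfile_natAdd]
    have hsub : ∀ Y : Finset (Fin (m + 1)),
        Y ⊆ ({p | mergeLast y p ∈ ({x} : Finset _)} : Finset _) →
        seats (f B) Y ≤ seats (f B) ({p | mergeLast y p ∈ ({x} : Finset _)} : Finset _) :=
      fun Y hY => Finset.sum_le_sum_of_subset hY
    by_cases hyx : y = x
    · subst hyx
      have h2 := hsub {y.castSucc, Fin.last m} (by
        intro p hp
        simp only [Finset.mem_insert, Finset.mem_singleton] at hp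
        rcases hp with rfl | rfl <;> simp)
      rw [seats, Finset.sum_pair (Fin.castSucc_lt_last y).ne] at h2
      simp only [Finset.mem_singleton, ↓reduceIte] at hS hle h2
      omega
    · have h1 := hsub {x.castSucc} (by simp)
      rw [seats_singleton] at h1
      simp only [Finset.mem_singleton, hyx, ↓reduceIte] at hS hle h1
      omega
  · intro A A' hA hA' i hAA'
    have h := hs _ _ (hA.extendProfile y q) (hA'.extendProfile y q) (Fin.castAdd q i) (by
      intro j hj
      induction j using Fin.addCases with
      | left j =>
        rw [extendProfile_castAdd, extendProfile_castAdd, hAA' j fun h => hj (by rw [h])]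
      | right j => rw [extendProfile_natAdd, extendProfile_natAdd])
    rw [extendProfile_castAdd, hseats hA, hseats hA'] at h
    exact Nat.le_of_add_le_add_right h

/-- Let `k ∣ n`. If there is no anonymous, weakly representative,
strategyproof party-approval rule for `n` voters, `m` parties, and committee size `k`,
then there is no such rule for `n(k+1)/k` voters, `m+1` parties, and committee size `k+1`. -/
theorem papp_impossibility_increase_committee_weakRep
    (k m n : ℕ) (hk : 1 ≤ k) (hm : 1 ≤ m) (hn : 1 ≤ n) (hdvd : k ∣ n)
    (h : ¬ ∃ f : (Fin n → Finset (Fin m)) → Multiset (Fin m),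
        IsPAPPRule n k f ∧ Anonymous n f ∧ WeakRep n k f ∧ Strategyproof n f) :
    ¬ ∃ f : (Fin (n * (k + 1) / k) → Finset (Fin (m + 1))) → Multiset (Fin (m + 1)),
        IsPAPPRule (n * (k + 1) / k) (k + 1) f ∧ Anonymous (n * (k + 1) / k) f ∧
          WeakRep (n * (k + 1) / k) (k + 1) f ∧ Strategyproof (n * (k + 1) / k) f := by
  obtain ⟨q, rfl⟩ := hdvd
  have hN : k * q * (k + 1) / k = k * q + q := by
    rw [mul_assoc, Nat.mul_div_cancel_left _ hk]
    ring
  rw [hN]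
  rintro ⟨f, hr, ha, hw, hs⟩
  exact h (exists_rule_of_exists_rule_add ⟨0, hm⟩ rfl hr ha hw hs hk)
end

section
/- Let w = (w_1, w_2, …) be a non-increasing sequence of nonnegative reals with w_1 = 1 that is neither the CCAV weight vector (1,0,0,…) nor the AV weight vector (1,1,1,…), and fix any family of linear tie-breaking orders ≻_k on committees. Then there exist a committee size k, a number of parties m, and a number of voters n such that the w-Thiele rule (with this tie-breaking) fails strategyproofness for unrepresented voters, i.e., there exist profiles A, A' and a voter i with A_j = A'_j for all j ≠ i, f(A, A_i) = 0, and f(A', A_i) > 0, where f denotes the w-Thiele rule. -/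
/-- The `w`-Thiele score of a committee `W` in the profile `A`:
`∑ i, (w 0 + w 1 + ⋯ + w (W(A_i) - 1))` (weights indexed from `0`, so `w 0` is the
paper's `w_1`). -/
noncomputable def thieleScore {P : Type*} [DecidableEq P] (w : ℕ → ℝ) {n : ℕ}
    (A : Fin n → Finset P) (W : Multiset P) : ℝ :=
  ∑ i : Fin n, ∑ j ∈ Finset.range (seats W (A i)), w j

/-- `f` is the `w`-Thiele rule for `n` voters and committee size `k`, with ties among
score-maximal committees broken by the (strict, linear) order `tb k`: for every valid
profile, `f A` is a committee of size `k` with maximal `w`-Thiele score that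
`tb k`-beats every other score-maximal committee of size `k`. -/
def IsThieleRule {P : Type*} [DecidableEq P] (w : ℕ → ℝ)
    (tb : ℕ → Multiset P → Multiset P → Prop) (n k : ℕ)
    (f : (Fin n → Finset P) → Multiset P) : Prop :=
  ∀ A, ValidProfile n A →
    Multiset.card (f A) = k ∧
    (∀ W : Multiset P, Multiset.card W = k → thieleScore w A W ≤ thieleScore w A (f A)) ∧
    (∀ W : Multiset P, Multiset.card W = k → W ≠ f A →
      thieleScore w A W = thieleScore w A (f A) → tb k (f A) W)

/-- Strategyproofness for unrepresented voters: a voter who approves no party of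
the elected committee cannot obtain a represented party by misreporting. -/
def SPUnrepresented {P : Type*} [DecidableEq P] (n : ℕ)
    (f : (Fin n → Finset P) → Multiset P) : Prop :=
  ∀ A A' : Fin n → Finset P, ValidProfile n A → ValidProfile n A' →
    ∀ i : Fin n, (∀ j, j ≠ i → A j = A' j) → seats (f A) (A i) = 0 →
      seats (f A') (A i) ≤ seats (f A) (A i)

/-- The contribution to the `w`-Thiele score of a voter with `n` representatives. -/
noncomputable def voterUtility (w : ℕ → ℝ) (n : ℕ) : ℝ := ∑ j ∈ Finset.range n, w j

theorem voterUtility_zero (w : ℕ → ℝ) : voterUtility w 0 = 0 := by simp [voterUtility]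

theorem voterUtility_one {w : ℕ → ℝ} (hw0 : w 0 = 1) : voterUtility w 1 = 1 := by
  simp [voterUtility, hw0]

theorem voterUtility_two {w : ℕ → ℝ} (hw0 : w 0 = 1) : voterUtility w 2 = 1 + w 1 := by
  simp [voterUtility, Finset.sum_range_succ, hw0]

theorem voterUtility_nonneg {w : ℕ → ℝ} (hw : ∀ j, 0 ≤ w j) (n : ℕ) :
    0 ≤ voterUtility w n :=
  Finset.sum_nonneg fun j _ => hw j

theorem voterUtility_eq_of_le {w : ℕ → ℝ} {u : ℕ} (h1 : ∀ j ≤ u, w j = 1) {n : ℕ}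
    (hn : n ≤ u + 1) : voterUtility w n = n := by
  rw [voterUtility, Finset.sum_congr rfl fun j hj =>
    h1 j (by have := Finset.mem_range.1 hj; omega)]
  simp

theorem voterUtility_le_sub {w : ℕ → ℝ} (hmono : ∀ i j : ℕ, i ≤ j → w j ≤ w i) {u : ℕ}
    (h1 : ∀ j ≤ u, w j = 1) (n : ℕ) :
    voterUtility w n ≤ n - (1 - w (u + 1)) * ((n - (u + 1) : ℕ) : ℝ) := by
  induction n with
  | zero => simp [voterUtility]
  | succ n ih =>
    rcases le_or_gt (n + 1) (u + 1) with h | h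
    · rw [voterUtility_eq_of_le h1 h, Nat.sub_eq_zero_of_le h]
      simp
    · have hs : voterUtility w (n + 1) = voterUtility w n + w n := by
        simp [voterUtility, Finset.sum_range_succ]
      have hw := hmono (u + 1) n (by omega)
      have hn : n + 1 - (u + 1) = (n - (u + 1)) + 1 := by omega
      rw [hs, hn]
      push_cast
      linarith

theorem voterUtility_le {w : ℕ → ℝ} (hw0 : w 0 = 1)
    (hmono : ∀ i j : ℕ, i ≤ j → w j ≤ w i) (n : ℕ) : voterUtility w n ≤ n := by
  calc voterUtility w n ≤ ∑ _j ∈ Finset.range n, (1 : ℝ) :=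
        Finset.sum_le_sum fun j _ => hw0 ▸ hmono 0 j (Nat.zero_le j)
    _ = n := by simp

theorem ValidProfile.cons {P : Type*} {n : ℕ} {X : Finset P} {A : Fin n → Finset P} (hX : X.Nonempty)
    (hA : ValidProfile n A) : ValidProfile (n + 1) (Fin.cons X A) := by
  intro i
  refine Fin.cases ?_ (fun j => ?_) i
  · simpa using hX
  · simpa using hA j

section ThieleScore

variable {P : Type*} [DecidableEq P]

theorem thieleScore_eq_sum (w : ℕ → ℝ) {n : ℕ} (A : Fin n → Finset P) (W : Multiset P) :
    thieleScore w A W = ∑ i, voterUtility w (seats W (A i)) := rfl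

theorem thieleScore_cons (w : ℕ → ℝ) {n : ℕ} (X : Finset P) (A : Fin n → Finset P)
    (W : Multiset P) :
    thieleScore w (Fin.cons X A : Fin (n + 1) → Finset P) W =
      voterUtility w (seats W X) + thieleScore w A W := by
  simp [thieleScore_eq_sum, Fin.sum_univ_succ]

theorem thieleScore_get (w : ℕ → ℝ) (l : List (Finset P)) (W : Multiset P) :
    thieleScore w l.get W = (l.map fun X => voterUtility w (seats W X)).sum := by
  rw [thieleScore_eq_sum]
  exact Fin.sum_univ_fun_getElem l fun X => voterUtility w (seats W X)

theorem seats_le_card [Fintype P] (W : Multiset P) (X : Finset P) :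
    seats W X ≤ Multiset.card W := by
  rw [← Multiset.sum_count_eq_card (s := Finset.univ) (m := W) (by simp)]
  exact Finset.sum_le_univ_sum_of_nonneg fun _ => Nat.zero_le _

theorem exists_isThieleRule [Fintype P] [Nonempty P] (w : ℕ → ℝ)
    (tb : ℕ → Multiset P → Multiset P → Prop)
    (htb : ∀ k, IsStrictTotalOrder (Multiset P) (tb k)) (n k : ℕ) :
    ∃ f, IsThieleRule w tb n k f := by
  classical
  have key : ∀ A : Fin n → Finset P, ∃ V : Multiset P, Multiset.card V = k ∧
      (∀ W : Multiset P, Multiset.card W = k → thieleScore w A W ≤ thieleScore w A V) ∧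
      (∀ W : Multiset P, Multiset.card W = k → W ≠ V →
        thieleScore w A W = thieleScore w A V → tb k V W) := by
    intro A
    have := htb k
    have hS : {W : Multiset P | Multiset.card W = k}.Finite :=
      Set.finite_coe_iff.1 (inferInstanceAs (Finite (Sym P k)))
    obtain ⟨p⟩ := ‹Nonempty P›
    obtain ⟨V₀, hV₀, hmax⟩ := hS.exists_maximalFor (thieleScore w A) _
      ⟨Multiset.replicate k p, by simp⟩
    have hle : ∀ W : Multiset P, Multiset.card W = k →
        thieleScore w A W ≤ thieleScore w A V₀ := fun W hW =>
      (le_total _ _).elim id fun h => hmax hW h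
    let T : Set (Multiset P) :=
      {W | Multiset.card W = k ∧ thieleScore w A W = thieleScore w A V₀}
    have hT : T.Finite := hS.subset fun W hW => hW.1
    obtain ⟨⟨V, hV⟩, -, hmin⟩ := (hT.wellFoundedOn (r := tb k)).has_min Set.univ
      ⟨⟨V₀, hV₀, rfl⟩, trivial⟩
    refine ⟨V, hV.1, fun W hW => (hle W hW).trans hV.2.ge, fun W hW hne heq => ?_⟩
    rcases trichotomous_of (tb k) V W with h | h | h
    · exact h
    · exact absurd h.symm hne
    · exact absurd h (hmin ⟨W, hW, heq.trans hV.2⟩ trivial)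
  choose f hf using key
  exact ⟨f, fun A _ => hf A⟩

theorem IsThieleRule.eq_of_forall {w : ℕ → ℝ} {tb : ℕ → Multiset P → Multiset P → Prop}
    {n k : ℕ} {f : (Fin n → Finset P) → Multiset P} (hf : IsThieleRule w tb n k f)
    (htb : IsStrictTotalOrder (Multiset P) (tb k)) {A : Fin n → Finset P}
    (hA : ValidProfile n A) {V : Multiset P} (hV : Multiset.card V = k)
    (h : ∀ W, Multiset.card W = k → W ≠ V → thieleScore w A W < thieleScore w A V ∨
      thieleScore w A W = thieleScore w A V ∧ tb k V W) : f A = V := by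
  obtain ⟨h1, h2, h3⟩ := hf A hA
  by_contra hne
  rcases h _ h1 hne with h4 | ⟨h4, h5⟩
  · exact absurd (h2 V hV) (not_le_of_gt h4)
  · exact asymm_of (tb k) h5 (h3 V hV (Ne.symm hne) h4.symm)

end ThieleScore

/-- The ballots of the voters that make `{0^u, 1, 2}` and `{0^u, 3, 4}` the two best
committees of size `u + 2`. -/
def baseBallots (N K : ℕ) : List (Finset (Fin 5)) :=
  List.replicate N {0, 1, 3} ++ List.replicate N {0, 1, 4} ++
  List.replicate N {0, 2, 3} ++ List.replicate N {0, 2, 4} ++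
  List.replicate K {1} ++ List.replicate K {2} ++
  List.replicate K {3} ++ List.replicate K {4}

theorem validProfile_baseBallots (N K : ℕ) :
    ValidProfile (baseBallots N K).length (baseBallots N K).get := by
  intro i
  have h : (baseBallots N K).get i ∈ baseBallots N K := List.get_mem _ _
  generalize (baseBallots N K).get i = X at h
  simp only [baseBallots, List.mem_append, List.mem_replicate] at h
  rcases h with ((((((h | h) | h) | h) | h) | h) | h) | h <;> rw [h.2] <;> simp

theorem thieleScore_baseBallots (w : ℕ → ℝ) (N K : ℕ) (W : Multiset (Fin 5)) :
    thieleScore w (baseBallots N K).get W =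
      N * (voterUtility w (W.count 0 + W.count 1 + W.count 3) +
        voterUtility w (W.count 0 + W.count 1 + W.count 4) +
        voterUtility w (W.count 0 + W.count 2 + W.count 3) +
        voterUtility w (W.count 0 + W.count 2 + W.count 4)) +
      K * (voterUtility w (W.count 1) + voterUtility w (W.count 2) +
        voterUtility w (W.count 3) + voterUtility w (W.count 4)) := by
  rw [thieleScore_get]
  simp [baseBallots, seats, List.sum_replicate, ← add_assoc]
  ring

/-- The committee with `u` seats for party `0` and one seat each for `p` and `q`. -/
def pairCommittee (u : ℕ) (p q : Fin 5) : Multiset (Fin 5) :=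
  Multiset.replicate u 0 + {p, q}

theorem card_pairCommittee (u : ℕ) (p q : Fin 5) :
    Multiset.card (pairCommittee u p q) = u + 2 := by
  simp [pairCommittee]

theorem count_pairCommittee (u : ℕ) (p q c : Fin 5) :
    (pairCommittee u p q).count c =
      (if c = 0 then u else 0) + ((if c = p then 1 else 0) + (if c = q then 1 else 0)) := by
  simp only [pairCommittee, Multiset.count_add, Multiset.count_replicate,
    Multiset.insert_eq_cons, Multiset.count_cons, Multiset.count_singleton, eq_comm (a := c)]
  ring

theorem pairCommittee_ne (u : ℕ) : pairCommittee u 1 2 ≠ pairCommittee u 3 4 := by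
  intro h
  have := congrArg (Multiset.count 1) h
  simp [count_pairCommittee] at this

theorem card_eq_sum_count (W : Multiset (Fin 5)) :
    W.count 0 + W.count 1 + W.count 2 + W.count 3 + W.count 4 = Multiset.card W := by
  rw [← Multiset.sum_count_eq_card (s := Finset.univ) (m := W) (by simp), Fin.sum_univ_five]

section BaseScore

variable {w : ℕ → ℝ} {u N K M : ℕ}

theorem thieleScore_baseBallots_pairCommittee (hw0 : w 0 = 1) (h1 : ∀ j ≤ u, w j = 1)
    (hK : K + M = 2 * N) {p q : Fin 5} (hpq : p = 1 ∧ q = 2 ∨ p = 3 ∧ q = 4) :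
    thieleScore w (baseBallots N K).get (pairCommittee u p q) =
      4 * N * (u + 2) - 2 * M := by
  have hKr : (K : ℝ) + M = 2 * N := by exact_mod_cast hK
  have hu : voterUtility w (u + 1) = u + 1 := by
    rw [voterUtility_eq_of_le h1 le_rfl]; push_cast; rfl
  rw [thieleScore_baseBallots]
  rcases hpq with ⟨rfl, rfl⟩ | ⟨rfl, rfl⟩ <;>
  · simp [count_pairCommittee, hu, voterUtility_zero, voterUtility_one hw0]
    linear_combination 2 * hKr

theorem thieleScore_baseBallots_le (hw0 : w 0 = 1)
    (hmono : ∀ i j : ℕ, i ≤ j → w j ≤ w i) (h1 : ∀ j ≤ u, w j = 1)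
    (hlt : w (u + 1) < 1) (hK : K + M = 2 * N) (hN : 3 * (M : ℝ) ≤ N * (1 - w (u + 1)))
    {W : Multiset (Fin 5)} (hW : Multiset.card W = u + 2)
    (hW1 : W ≠ pairCommittee u 1 2) (hW2 : W ≠ pairCommittee u 3 4) :
    thieleScore w (baseBallots N K).get W + M ≤ 4 * N * (u + 2) - 2 * M := by
  rw [← card_eq_sum_count] at hW
  have hne : ∀ p q : Fin 5, W ≠ pairCommittee u p q →
      ¬ (W.count 0 = (pairCommittee u p q).count 0 ∧ W.count 1 = (pairCommittee u p q).count 1 ∧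
        W.count 2 = (pairCommittee u p q).count 2 ∧ W.count 3 = (pairCommittee u p q).count 3 ∧
        W.count 4 = (pairCommittee u p q).count 4) := by
    rintro p q h ⟨c0, c1, c2, c3, c4⟩
    refine h (Multiset.ext.2 fun c => ?_)
    fin_cases c <;> assumption
  replace hW1 := hne 1 2 hW1
  replace hW2 := hne 3 4 hW2
  simp [count_pairCommittee, -Multiset.count_eq_zero] at hW1 hW2
  rw [thieleScore_baseBallots]
  generalize W.count 0 = e at *
  generalize W.count 1 = a at *
  generalize W.count 2 = b at *
  generalize W.count 3 = x at *
  generalize W.count 4 = z at *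
  have hKr : (K : ℝ) + M = 2 * N := by exact_mod_cast hK
  have hWr : (e : ℝ) + a + b + x + z = u + 2 := by exact_mod_cast hW
  have hg := voterUtility_le_sub hmono h1
  have g1 := hg (e + a + x)
  have g2 := hg (e + a + z)
  have g3 := hg (e + b + x)
  have g4 := hg (e + b + z)
  have hl := voterUtility_le hw0 hmono
  have l1 := hl a
  have l2 := hl b
  have l3 := hl x
  have l4 := hl z
  obtain ⟨D, hD⟩ : ∃ D, D = (e + a + x - (u + 1)) + (e + a + z - (u + 1)) +
    (e + b + x - (u + 1)) + (e + b + z - (u + 1)) := ⟨_, rfl⟩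
  have hDr := congrArg (Nat.cast (R := ℝ)) hD
  have hcase : 1 ≤ D ∨ e + 1 ≤ u := by omega
  clear hD hW1 hW2
  push_cast at g1 g2 g3 g4 hDr
  generalize ((e + a + x - (u + 1) : ℕ) : ℝ) = d1 at *
  generalize ((e + a + z - (u + 1) : ℕ) : ℝ) = d2 at *
  generalize ((e + b + x - (u + 1) : ℕ) : ℝ) = d3 at *
  generalize ((e + b + z - (u + 1) : ℕ) : ℝ) = d4 at *
  set L : ℝ := 1 - w (u + 1)
  have hLpos : 0 < L := by linarith
  have hG : voterUtility w (e + a + x) + voterUtility w (e + a + z) +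
      voterUtility w (e + b + x) + voterUtility w (e + b + z) ≤
      4 * e + 2 * (u + 2 - e) - L * D := by
    rw [hDr]; linarith
  have hl' : voterUtility w a + voterUtility w b + voterUtility w x + voterUtility w z ≤
      u + 2 - e := by linarith
  have m1 := mul_le_mul_of_nonneg_left hG (Nat.cast_nonneg (α := ℝ) N)
  have m2 := mul_le_mul_of_nonneg_left hl' (Nat.cast_nonneg (α := ℝ) K)
  have hKe : (K : ℝ) = 2 * N - M := by linarith
  have hbound : (N : ℝ) * (4 * e + 2 * (u + 2 - e) - L * D) + K * (u + 2 - e) =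
      4 * N * (u + 2) - M * (u + 2 - e) - N * L * D := by rw [hKe]; ring
  have hM0 : (0 : ℝ) ≤ M := Nat.cast_nonneg M
  have hNL : (0 : ℝ) ≤ N * L := by positivity
  have hk : (0 : ℝ) ≤ u + 2 - e := by
    have : (e : ℝ) ≤ u + 2 := by exact_mod_cast (by omega : e ≤ u + 2)
    linarith
  rcases hcase with h | h
  · have hD1 : (1 : ℝ) ≤ D := by exact_mod_cast h
    have t1 := mul_le_mul_of_nonneg_left hD1 hNL
    have t2 := mul_nonneg hM0 hk
    linarith
  · have he : (3 : ℝ) ≤ u + 2 - e := by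
      have : (e : ℝ) + 1 ≤ u := by exact_mod_cast h
      linarith
    have t1 := mul_le_mul_of_nonneg_left he hM0
    have t2 := mul_nonneg hNL (Nat.cast_nonneg (α := ℝ) D)
    linarith

end BaseScore

/-- If one of the two committees `{0^u, 1, 2}` and `{0^u, 3, 4}` is preferred to the other
in the base profile extended by two voters, then it is selected. -/
theorem IsThieleRule.eq_pairCommittee {w : ℕ → ℝ} {u N K : ℕ} (hw0 : w 0 = 1)
    (hmono : ∀ i j : ℕ, i ≤ j → w j ≤ w i) (hnonneg : ∀ j, 0 ≤ w j)
    (h1 : ∀ j ≤ u, w j = 1) (hlt : w (u + 1) < 1) (hK : K + (2 * u + 5) = 2 * N)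
    (hN : 3 * ((2 * u + 5 : ℕ) : ℝ) ≤ N * (1 - w (u + 1)))
    {tb : ℕ → Multiset (Fin 5) → Multiset (Fin 5) → Prop}
    (htb : IsStrictTotalOrder (Multiset (Fin 5)) (tb (u + 2)))
    {f : (Fin ((baseBallots N K).length + 1 + 1) → Finset (Fin 5)) → Multiset (Fin 5)}
    (hf : IsThieleRule w tb _ (u + 2) f) {X Y : Finset (Fin 5)}
    (hX : X.Nonempty) (hY : Y.Nonempty) {V V' : Multiset (Fin 5)}
    (hVV' : V = pairCommittee u 1 2 ∧ V' = pairCommittee u 3 4 ∨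
      V = pairCommittee u 3 4 ∧ V' = pairCommittee u 1 2)
    (h : voterUtility w (seats V' X) + voterUtility w (seats V' Y) <
        voterUtility w (seats V X) + voterUtility w (seats V Y) ∨
      voterUtility w (seats V' X) + voterUtility w (seats V' Y) =
        voterUtility w (seats V X) + voterUtility w (seats V Y) ∧ tb (u + 2) V V') :
    f (Fin.cons X (Fin.cons Y (baseBallots N K).get : Fin _ → Finset (Fin 5))) = V := by
  have s1 := thieleScore_baseBallots_pairCommittee hw0 h1 hK (.inl ⟨rfl, rfl⟩)
  have s2 := thieleScore_baseBallots_pairCommittee hw0 h1 hK (.inr ⟨rfl, rfl⟩)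
  have sV : thieleScore w (baseBallots N K).get V =
      4 * N * (u + 2) - 2 * (2 * u + 5 : ℕ) := by
    rcases hVV' with ⟨rfl, -⟩ | ⟨rfl, -⟩ <;> assumption
  have sV' : thieleScore w (baseBallots N K).get V' =
      4 * N * (u + 2) - 2 * (2 * u + 5 : ℕ) := by
    rcases hVV' with ⟨-, rfl⟩ | ⟨-, rfl⟩ <;> assumption
  have cV : Multiset.card V = u + 2 := by
    rcases hVV' with ⟨rfl, -⟩ | ⟨rfl, -⟩ <;> exact card_pairCommittee ..
  refine hf.eq_of_forall htb (((validProfile_baseBallots N K).cons hY).cons hX) cV ?_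
  intro W hW hne
  simp only [thieleScore_cons]
  by_cases hWV' : W = V'
  · subst hWV'
    rw [sV, sV', ← add_assoc, ← add_assoc]
    simpa using h
  · left
    have hb : thieleScore w (baseBallots N K).get W + (2 * u + 5 : ℕ) ≤
        4 * N * (u + 2) - 2 * (2 * u + 5 : ℕ) := by
      refine thieleScore_baseBallots_le hw0 hmono h1 hlt hK hN hW ?_ ?_ <;>
        rcases hVV' with ⟨rfl, rfl⟩ | ⟨rfl, rfl⟩ <;> assumption
    have hu : ∀ Z : Finset (Fin 5), voterUtility w (seats W Z) ≤ u + 2 := fun Z =>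
      (voterUtility_le hw0 hmono _).trans (by exact_mod_cast hW ▸ seats_le_card W Z)
    have v1 := hu X
    have v2 := hu Y
    have v3 := voterUtility_nonneg hnonneg (seats V X)
    have v4 := voterUtility_nonneg hnonneg (seats V Y)
    push_cast at hb sV
    linarith

/-- Let `w` be a non-increasing sequence of nonnegative reals with
`w 0 = 1` that is neither the CCAV weight vector `(1,0,0,…)` nor the AV weight vector
`(1,1,1,…)`, and fix any family of linear tie-breaking orders on committees. Then
there exist a committee size `k`, a number of parties `m`, and a number of voters `n`
such that the `w`-Thiele rule fails strategyproofness for unrepresented voters: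
there are profiles `A, A'` and a voter `i` with `A j = A' j` for `j ≠ i`,
`f(A, A_i) = 0` and `f(A', A_i) > 0`. -/
theorem thiele_not_ccav_not_av_fails_SPUnrepresented
    (w : ℕ → ℝ) (hw0 : w 0 = 1)
    (hmono : ∀ i j : ℕ, i ≤ j → w j ≤ w i) (hnonneg : ∀ j : ℕ, 0 ≤ w j)
    (hnotCCAV : ¬ ∀ j : ℕ, 1 ≤ j → w j = 0)
    (hnotAV : ¬ ∀ j : ℕ, w j = 1)
    (tb : ∀ m : ℕ, ℕ → Multiset (Fin m) → Multiset (Fin m) → Prop)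
    (htb : ∀ m k : ℕ, IsStrictTotalOrder (Multiset (Fin m)) (tb m k)) :
    ∃ (n m k : ℕ) (f : (Fin n → Finset (Fin m)) → Multiset (Fin m)),
      IsThieleRule w (tb m) n k f ∧
      ∃ (A A' : Fin n → Finset (Fin m)) (i : Fin n),
        ValidProfile n A ∧ ValidProfile n A' ∧ (∀ j, j ≠ i → A j = A' j) ∧
        seats (f A) (A i) = 0 ∧ 0 < seats (f A') (A i) := by
  classical
  obtain ⟨u, h1, hlt⟩ : ∃ u, (∀ j ≤ u, w j = 1) ∧ w (u + 1) < 1 := by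
    have hex : ∃ j, w j ≠ 1 := not_forall.1 hnotAV
    obtain ⟨u, hu⟩ : ∃ u, Nat.find hex = u + 1 :=
      Nat.exists_eq_succ_of_ne_zero fun h0 => Nat.find_spec hex (by rw [h0, hw0])
    refine ⟨u, fun j hj => not_not.1 (Nat.find_min hex (by omega)), ?_⟩
    exact lt_of_le_of_ne (hw0 ▸ hmono 0 _ (Nat.zero_le _)) (hu ▸ Nat.find_spec hex)
  have hw1 : 0 < w 1 := by
    push Not at hnotCCAV
    obtain ⟨j, hj, hne⟩ := hnotCCAV
    exact (lt_of_le_of_ne (hnonneg j) hne.symm).trans_le (hmono 1 j hj)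
  obtain ⟨N, hN⟩ : ∃ N : ℕ, 3 * ((2 * u + 5 : ℕ) : ℝ) ≤ N * (1 - w (u + 1)) := by
    obtain ⟨N, hN⟩ := exists_nat_ge (3 * ((2 * u + 5 : ℕ) : ℝ) / (1 - w (u + 1)))
    exact ⟨N, (div_le_iff₀ (by linarith)).1 hN⟩
  obtain ⟨K, hK⟩ : ∃ K, K + (2 * u + 5) = 2 * N := by
    have hle : ((2 * u + 5 : ℕ) : ℝ) ≤ N := by
      have h2 : (N : ℝ) * (1 - w (u + 1)) ≤ N * 1 :=
        mul_le_mul_of_nonneg_left (by linarith [hnonneg (u + 1)]) (Nat.cast_nonneg N)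
      have h3 : (0 : ℝ) ≤ (2 * u + 5 : ℕ) := Nat.cast_nonneg _
      linarith
    have hle' : 2 * u + 5 ≤ N := by exact_mod_cast hle
    exact ⟨2 * N - (2 * u + 5), by omega⟩
  have htb' := htb 5 (u + 2)
  obtain ⟨f, hf⟩ := exists_isThieleRule w (tb 5) (htb 5)
    ((baseBallots N K).length + 1 + 1) (u + 2)
  obtain ⟨Y, hY, hA, hA'⟩ : ∃ Y : Finset (Fin 5), Y.Nonempty ∧
      f (Fin.cons {3} (Fin.cons Y (baseBallots N K).get : Fin _ → Finset (Fin 5))) =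
        pairCommittee u 1 2 ∧
      f (Fin.cons {3, 4} (Fin.cons Y (baseBallots N K).get : Fin _ → Finset (Fin 5))) =
        pairCommittee u 3 4 := by
    have sel {X Y : Finset (Fin 5)} (hX : X.Nonempty) (hY : Y.Nonempty) {V V'} hVV' h :=
      hf.eq_pairCommittee hw0 hmono hnonneg h1 hlt hK hN htb' (V := V) (V' := V') hX hY hVV' h
    rcases trichotomous_of (tb 5 (u + 2)) (pairCommittee u 1 2) (pairCommittee u 3 4)
      with h | h | h
    · refine ⟨{1}, by simp, sel (by simp) (by simp) (.inl ⟨rfl, rfl⟩) (.inr ⟨?_, h⟩),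
        sel (by simp) (by simp) (.inr ⟨rfl, rfl⟩) (.inl ?_)⟩ <;>
      simp [seats, count_pairCommittee, voterUtility_zero, voterUtility_one hw0,
        voterUtility_two hw0, hw1]
    · exact absurd h (pairCommittee_ne u)
    · refine ⟨{1, 2}, by simp, sel (by simp) (by simp) (.inl ⟨rfl, rfl⟩) (.inl ?_),
        sel (by simp) (by simp) (.inr ⟨rfl, rfl⟩) (.inr ⟨?_, h⟩)⟩ <;>
      simp [seats, count_pairCommittee, voterUtility_zero, voterUtility_one hw0,
        voterUtility_two hw0, hw1]
  refine ⟨_, 5, u + 2, f, hf, _, _, 0,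
    ((validProfile_baseBallots N K).cons hY).cons (X := {3}) (by simp),
    ((validProfile_baseBallots N K).cons hY).cons (X := {3, 4}) (by simp), ?_, ?_, ?_⟩
  · intro j hj
    obtain ⟨i, rfl⟩ := Fin.exists_succ_eq.2 hj
    simp
  · rw [hA]
    simp [seats, count_pairCommittee]
  · rw [hA']
    simp [seats, count_pairCommittee]
end
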